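/- If P is uniformly distributed on the probability simplex of dimension S−1 (distributions on S symbols), X₁,…,Xₙ | P are i.i.d. ∼ P, and P̂ is the empirical distribution, then I(P; X^n) ≥ log₂(1/(S−1)!) + ((S−1)/2)·log₂(n(S−1)/(2πe)). Consequently, if S = αn with 0 < α < e/(2π), the normalized minimax redundancy inf_Q sup_P (1/n)D(P_{X^n}‖Q_{X^n}) is at least (α/2)log₂(e/(2πα)) − O(log n / n). -/

import Mathlib

open MeasureTheory Real

/-- Parametrization of a distribution on `S` symbols by its first `S-1` coordinates
`y : Fin (S-1) → ℝ`; the last symbol gets the remaining mass `1 - ∑ y i`. -/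
noncomputable def fullDist (S : ℕ) (y : Fin (S - 1) → ℝ) : Fin S → ℝ :=
  fun j => if h : (j : ℕ) < S - 1 then y ⟨j, h⟩ else 1 - ∑ i, y i

/-- The uniform (Dirichlet(1,…,1)) prior on distributions over `S` symbols, in the
coordinates `y : Fin (S-1) → ℝ`: the normalized Lebesgue measure on
`{y : y ≥ 0, ∑ y ≤ 1}`. -/
noncomputable def uniformPrior (S : ℕ) : Measure (Fin (S - 1) → ℝ) :=
  (volume {y : Fin (S - 1) → ℝ | (∀ i, 0 ≤ y i) ∧ ∑ i, y i ≤ 1})⁻¹ •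
    volume.restrict {y : Fin (S - 1) → ℝ | (∀ i, 0 ≤ y i) ∧ ∑ i, y i ≤ 1}

/-- The mutual information `I(P; X^n)` under the uniform prior, expressed via its standard
characterization `I(P;X^n) = ∫ D(P_{X^n} ‖ Q̄) dπ(P)` with `Q̄` the mixture of `P_{X^n}`
(KL divergence in bits). -/
noncomputable def mutInfo (S n : ℕ) : ℝ :=
  ∫ y, ∑ xs : Fin n → Fin S,
      (∏ i, fullDist S y (xs i)) * Real.logb 2
        ((∏ i, fullDist S y (xs i)) /
          ∫ y', ∏ i, fullDist S y' (xs i) ∂(uniformPrior S)) ∂(uniformPrior S)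

/-- The normalized minimax redundancy `inf_Q sup_{P ∈ D₀(S)} (1/n) D(P_{X^n} ‖ Q_{X^n})`
(in bits; `Q` ranges over strictly positive coding distributions on length-`n` sequences). -/
noncomputable def minimaxRedundancy (S n : ℕ) : ℝ :=
  sInf { r : ℝ | ∃ Q : (Fin n → Fin S) → ℝ,
      (∀ xs, 0 < Q xs) ∧ (∑ xs, Q xs = 1) ∧
      r = sSup { d : ℝ | ∃ p ∈ stdSimplex ℝ (Fin S),
          d = (1 / n) * ∑ xs : Fin n → Fin S,
            (∏ i, p (xs i)) * Real.logb 2 ((∏ i, p (xs i)) / Q xs) } }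


/-- the solid simplex -/
def Dlt (d : ℕ) : Set (Fin d → ℝ) := {y : Fin d → ℝ | (∀ i, 0 ≤ y i) ∧ ∑ i, y i ≤ 1}

lemma Dlt_le_one {d : ℕ} {y : Fin d → ℝ} (hy : y ∈ Dlt d) (i : Fin d) : y i ≤ 1 :=
  (Finset.single_le_sum (fun j _ => hy.1 j) (Finset.mem_univ i)).trans hy.2

lemma Dlt_closed (d : ℕ) : IsClosed (Dlt d) := by
  have : Dlt d = (⋂ i, {y : Fin d → ℝ | 0 ≤ y i}) ∩ {y | ∑ i, y i ≤ 1} := by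
    ext y; simp [Dlt]
  rw [this]
  refine IsClosed.inter (isClosed_iInter fun i => isClosed_le continuous_const (continuous_apply i)) ?_
  exact isClosed_le (by fun_prop) continuous_const

lemma Dlt_compact (d : ℕ) : IsCompact (Dlt d) := by
  refine IsCompact.of_isClosed_subset (isCompact_Icc (a := (0 : Fin d → ℝ)) (b := 1)) (Dlt_closed d) ?_
  intro y hy
  exact ⟨fun i => hy.1 i, fun i => Dlt_le_one hy i⟩

lemma Dlt_vol (d : ℕ) (hd : 1 ≤ d) : (1 / (d.factorial : ℝ)) ≤ (volume (Dlt d)).toReal := by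
  have : Nonempty (Fin d) := ⟨⟨0, hd⟩⟩
  have h1 := MeasureTheory.volume_sum_rpow_lt_one (Fin d) (p := 1) le_rfl
  have hfin : volume (Dlt d) ≠ ⊤ := (Dlt_compact d).measure_lt_top.ne
  let T : (Fin d → Bool) → (Fin d → ℝ) → (Fin d → ℝ) := fun ε y i => if ε i then y i else - y i
  have hT : ∀ ε, MeasurePreserving (T ε) := by
    intro ε
    refine MeasureTheory.volume_preserving_pi (f := fun i (t : ℝ) => if ε i then t else -t) ?_
    intro i
    by_cases h : ε i
    · simpa [h] using! MeasurePreserving.id (volume : Measure ℝ)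
    · simpa [h] using! Measure.measurePreserving_neg (volume : Measure ℝ)
  have hsub : {x : Fin d → ℝ | ∑ i, |x i| ^ (1:ℝ) < 1} ⊆ ⋃ ε, (T ε) ⁻¹' (Dlt d) := by
    intro x hx
    simp only [Real.rpow_one, Set.mem_ofPred_eq] at hx
    refine Set.mem_iUnion.2 ⟨fun i => decide (0 ≤ x i), ?_⟩
    have : T (fun i => decide (0 ≤ x i)) x = fun i => |x i| := by
      funext i
      by_cases h : 0 ≤ x i
      · simp [T, h, abs_of_nonneg]
      · simp [T, h, abs_of_neg (not_le.1 h)]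
    rw [Set.mem_preimage, this]
    exact ⟨fun i => abs_nonneg _, hx.le⟩
  have h2 : volume {x : Fin d → ℝ | ∑ i, |x i| ^ (1:ℝ) < 1} ≤ 2 ^ d * volume (Dlt d) := by
    refine (measure_mono hsub).trans ((measure_iUnion_le _).trans ?_)
    simp only [(hT _).measure_preimage (Dlt_closed d).measurableSet.nullMeasurableSet]
    simp [tsum_fintype]
  rw [h1] at h2
  have h3 := ENNReal.toReal_mono (by finiteness) h2
  rw [ENNReal.toReal_ofReal (by positivity)] at h3
  simp only [div_one, Fintype.card_fin, ENNReal.toReal_mul, ENNReal.toReal_pow, ENNReal.toReal_ofNat, Real.Gamma_nat_eq_factorial] at h3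
  rw [show (1:ℝ) + 1 = ((1:ℕ):ℝ) + 1 by norm_num, Real.Gamma_nat_eq_factorial] at h3
  simp only [Nat.factorial_one, Nat.cast_one, mul_one] at h3
  have : (0:ℝ) < 2 ^ d := by positivity
  rw [div_eq_mul_one_div] at h3
  exact le_of_mul_le_mul_left h3 this

lemma fullDist_nonneg {S : ℕ} {y : Fin (S-1) → ℝ} (hy : y ∈ Dlt (S-1)) (j : Fin S) :
    0 ≤ fullDist S y j := by
  unfold fullDist
  split_ifs with h
  · exact hy.1 _
  · linarith [hy.2]

lemma fullDist_sum {S : ℕ} (hS : 1 ≤ S) (y : Fin (S-1) → ℝ) : ∑ j, fullDist S y j = 1 := by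
  obtain ⟨d, rfl⟩ : ∃ d, S = d + 1 := ⟨S - 1, by omega⟩
  rw [Fin.sum_univ_castSucc]
  have : ∀ i : Fin d, fullDist (d+1) y i.castSucc = y i := by
    intro i; simp [fullDist]
  simp only [this]
  simp [fullDist]

lemma fullDist_cont (S : ℕ) (j : Fin S) : Continuous (fun y => fullDist S y j) := by
  unfold fullDist
  split_ifs with h <;> fun_prop

lemma cont_prod (S n : ℕ) (xs : Fin n → Fin S) :
    Continuous (fun y => ∏ i, fullDist S y (xs i)) :=
  continuous_finsetProd _ fun i _ => fullDist_cont S (xs i)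

lemma prod_sum_one {S : ℕ} (n : ℕ) (p : Fin S → ℝ) (hp : ∑ j, p j = 1) :
    ∑ xs : Fin n → Fin S, ∏ i, p (xs i) = 1 := by
  have := Finset.sum_pow' (Finset.univ : Finset (Fin S)) p n
  simp only [Fintype.piFinset_univ] at this
  rw [← this, hp, one_pow]

lemma sum_cons {S n : ℕ} (F : (Fin (n+1) → Fin S) → ℝ) :
    ∑ xs, F xs = ∑ a, ∑ xs : Fin n → Fin S, F (Fin.cons a xs) := by
  rw [← (Fin.consEquiv (fun _ : Fin (n+1) => Fin S)).sum_comp, Fintype.sum_prod_type]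
  rfl

lemma moment1 {S : ℕ} (n : ℕ) (p f : Fin S → ℝ) (hp : ∑ j, p j = 1) (hf : ∑ j, p j * f j = 0) :
    ∑ xs : Fin n → Fin S, (∏ i, p (xs i)) * ∑ i, f (xs i) = 0 := by
  induction n with
  | zero => simp
  | succ n ih =>
    rw [sum_cons]
    simp only [Fin.prod_univ_succ, Fin.sum_univ_succ, Fin.cons_zero, Fin.cons_succ]
    have : ∀ a, ∑ xs : Fin n → Fin S, p a * (∏ i, p (xs i)) * (f a + ∑ i, f (xs i)) = p a * f a := by
      intro a
      have : ∀ xs : Fin n → Fin S, p a * (∏ i, p (xs i)) * (f a + ∑ i, f (xs i))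
        = p a * f a * (∏ i, p (xs i)) + p a * ((∏ i, p (xs i)) * ∑ i, f (xs i)) := by intro xs; ring
      simp only [this, Finset.sum_add_distrib, ← Finset.mul_sum, ih, prod_sum_one n p hp]
      ring
    simp only [this, hf]

lemma moment2 {S : ℕ} (n : ℕ) (p f : Fin S → ℝ) (hp : ∑ j, p j = 1) (hf : ∑ j, p j * f j = 0) :
    ∑ xs : Fin n → Fin S, (∏ i, p (xs i)) * (∑ i, f (xs i)) ^ 2 = n * ∑ j, p j * f j ^ 2 := by
  induction n with
  | zero => simp
  | succ n ih =>
    rw [sum_cons]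
    simp only [Fin.prod_univ_succ, Fin.sum_univ_succ, Fin.cons_zero, Fin.cons_succ]
    have : ∀ a, ∑ xs : Fin n → Fin S, p a * (∏ i, p (xs i)) * (f a + ∑ i, f (xs i)) ^ 2
        = p a * f a ^ 2 + p a * (n * ∑ j, p j * f j ^ 2) := by
      intro a
      have : ∀ xs : Fin n → Fin S, p a * (∏ i, p (xs i)) * (f a + ∑ i, f (xs i)) ^ 2
        = p a * f a ^ 2 * (∏ i, p (xs i)) + 2 * p a * f a * ((∏ i, p (xs i)) * ∑ i, f (xs i))
          + p a * ((∏ i, p (xs i)) * (∑ i, f (xs i)) ^ 2) := by intro xs; ring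
      simp only [this, Finset.sum_add_distrib, ← Finset.mul_sum, ih, prod_sum_one n p hp,
        moment1 n p f hp hf]
      ring
    simp only [this, Finset.sum_add_distrib, ← Finset.sum_mul, hp]
    push_cast; ring

/-- empirical frequency of symbol `j` -/
noncomputable def emp {S n : ℕ} (xs : Fin n → Fin S) (j : Fin S) : ℝ :=
  (∑ i, if xs i = j then (1:ℝ) else 0) / n

lemma emp_var {S n : ℕ} (hn : 1 ≤ n) (p : Fin S → ℝ) (hp : ∑ j, p j = 1) (j : Fin S) :
    ∑ xs : Fin n → Fin S, (∏ i, p (xs i)) * (p j - emp xs j) ^ 2 = p j * (1 - p j) / n := by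
  have hn' : (n:ℝ) ≠ 0 := by positivity
  have hf : ∑ k, p k * ((if k = j then (1:ℝ) else 0) - p j) = 0 := by
    simp [mul_sub, Finset.sum_sub_distrib, ← Finset.sum_mul, hp]
  have h := moment2 n p (fun k => (if k = j then (1:ℝ) else 0) - p j) hp hf
  have h2 : ∑ k, p k * ((if k = j then (1:ℝ) else 0) - p j) ^ 2 = p j * (1 - p j) := by
    have : ∀ k, p k * ((if k = j then (1:ℝ) else 0) - p j) ^ 2
        = (if k = j then p k * (1 - 2 * p j) else 0) + p k * p j ^ 2 := by
      intro k; split_ifs <;> ring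
    simp only [this, Finset.sum_add_distrib, ← Finset.sum_mul, hp]
    simp; ring
  rw [h2] at h
  have h3 : ∀ xs : Fin n → Fin S, (p j - emp xs j) ^ 2
      = (∑ i, ((if xs i = j then (1:ℝ) else 0) - p j)) ^ 2 / n ^ 2 := by
    intro xs
    rw [Finset.sum_sub_distrib]
    simp only [emp, Finset.sum_const, Finset.card_univ, Fintype.card_fin, nsmul_eq_mul]
    field_simp; ring
  simp only [h3, ← mul_div_assoc, ← Finset.sum_div, h]
  field_simp

/-- index embedding -/
def emb {S : ℕ} (i : Fin (S-1)) : Fin S := ⟨i, by omega⟩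

lemma fullDist_emb {S : ℕ} (y : Fin (S-1) → ℝ) (i : Fin (S-1)) : fullDist S y (emb i) = y i := by
  simp [fullDist, emb]

lemma total_var {S n : ℕ} (hS : 1 ≤ S) (hn : 1 ≤ n) (y : Fin (S-1) → ℝ) (hy : y ∈ Dlt (S-1)) :
    ∑ xs : Fin n → Fin S, (∏ i, fullDist S y (xs i)) * ∑ i, (y i - emp xs (emb i)) ^ 2 ≤ 1 / n := by
  simp only [Finset.mul_sum]
  rw [Finset.sum_comm]
  have : ∀ i, ∑ xs : Fin n → Fin S, (∏ k, fullDist S y (xs k)) * (y i - emp xs (emb i)) ^ 2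
      ≤ y i / n := by
    intro i
    have := emp_var hn (fullDist S y) (fullDist_sum hS y) (emb i)
    rw [fullDist_emb] at this
    rw [this]
    gcongr
    nlinarith [hy.1 i, sq_nonneg (y i)]
  refine (Finset.sum_le_sum fun i _ => this i).trans ?_
  rw [← Finset.sum_div]
  gcongr
  exact hy.2

/-- Gaussian density -/
noncomputable def gau {d : ℕ} (b : ℝ) (c y : Fin d → ℝ) : ℝ :=
  ∏ i, (√(b / π) * Real.exp (-b * (y i - c i) ^ 2))

lemma gau_pos {d : ℕ} {b : ℝ} (hb : 0 < b) (c y : Fin d → ℝ) : 0 < gau b c y := by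
  have := Real.pi_pos
  exact Finset.prod_pos fun i _ => by positivity

lemma gau_int {d : ℕ} {b : ℝ} (hb : 0 < b) (c : Fin d → ℝ) :
    Integrable (gau b c) ∧ ∫ y, gau b c y = 1 := by
  have hpi := Real.pi_pos
  constructor
  · refine Integrable.fintype_prod (f := fun i t => √(b / π) * Real.exp (-b * (t - c i) ^ 2)) ?_
    intro i
    exact ((integrable_exp_neg_mul_sq hb).comp_sub_right (c i)).const_mul _
  · have := integral_fintype_prod_volume_eq_prod (𝕜 := ℝ)
      (fun i t => √(b / π) * Real.exp (-b * (t - c i) ^ 2))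
    refine this.trans (Finset.prod_eq_one fun i _ => ?_)
    rw [integral_const_mul, integral_sub_right_eq_self (fun t => Real.exp (-b * t ^ 2)), integral_gaussian,
      ← Real.sqrt_mul (by positivity)]
    rw [show b / π * (π / b) = 1 by field_simp, Real.sqrt_one]

lemma gau_log {d : ℕ} {b : ℝ} (hb : 0 < b) (c y : Fin d → ℝ) :
    Real.log (gau b c y) = d / 2 * Real.log (b / π) - b * ∑ i, (y i - c i) ^ 2 := by
  have hpi := Real.pi_pos
  unfold gau
  rw [Real.log_prod fun i _ => by positivity]
  have : ∀ i, Real.log (√(b / π) * Real.exp (-b * (y i - c i) ^ 2))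
      = Real.log (b / π) / 2 - b * (y i - c i) ^ 2 := by
    intro i
    rw [Real.log_mul (by positivity) (by positivity), Real.log_sqrt (by positivity), Real.log_exp]
    ring
  simp only [this, Finset.sum_sub_distrib, ← Finset.mul_sum]
  simp; ring

lemma prior_eq (S : ℕ) : uniformPrior S = (volume (Dlt (S-1)))⁻¹ • volume.restrict (Dlt (S-1)) := rfl

lemma Dlt_vol_pos (d : ℕ) (hd : 1 ≤ d) : 0 < (volume (Dlt d)).toReal :=
  lt_of_lt_of_le (by positivity) (Dlt_vol d hd)

lemma prior_prob {S : ℕ} (hS : 2 ≤ S) : IsProbabilityMeasure (uniformPrior S) := by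
  constructor
  have h := Dlt_vol_pos (S-1) (by omega)
  rw [ENNReal.toReal_pos_iff] at h
  rw [prior_eq]
  simp [ENNReal.inv_mul_cancel h.1.ne' h.2.ne]

lemma prior_ae {S : ℕ} : ∀ᵐ y ∂(uniformPrior S), y ∈ Dlt (S-1) := by
  rw [prior_eq]
  exact Measure.ae_smul_measure (ae_restrict_mem (Dlt_closed _).measurableSet) _

lemma prior_integrable {S : ℕ} (hS : 2 ≤ S) {f : (Fin (S-1) → ℝ) → ℝ} (hf : Continuous f) :
    Integrable f (uniformPrior S) := by
  have h := Dlt_vol_pos (S-1) (by omega)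
  rw [ENNReal.toReal_pos_iff] at h
  rw [prior_eq]
  exact (hf.continuousOn.integrableOn_compact (Dlt_compact _)).smul_measure
    (ENNReal.inv_ne_top.2 h.1.ne')

lemma prior_gau {S : ℕ} (hS : 2 ≤ S) {b : ℝ} (hb : 0 < b) (c : Fin (S-1) → ℝ) :
    (volume (Dlt (S-1))).toReal * ∫ y, gau b c y ∂(uniformPrior S) ≤ 1 := by
  have h := Dlt_vol_pos (S-1) (by omega)
  rw [prior_eq, integral_smul_measure, ENNReal.toReal_inv, smul_eq_mul, mul_inv_cancel_left₀ h.ne',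
    ← (gau_int hb c).2]
  exact setIntegral_le_integral (gau_int hb c).1 (Filter.Eventually.of_forall fun y => (gau_pos hb c y).le)

lemma cont_gau {d : ℕ} (b : ℝ) (c : Fin d → ℝ) : Continuous (gau b c) := by
  unfold gau; fun_prop

lemma cont_plog {S n : ℕ} (xs : Fin n → Fin S) (q : ℝ) :
    Continuous (fun y => (∏ i, fullDist S y (xs i)) * Real.log ((∏ i, fullDist S y (xs i)) / q)) := by
  by_cases hq : q = 0
  · simp only [hq, div_zero, Real.log_zero, mul_zero]; exact continuous_const
  have h := (Real.continuous_mul_log.comp ((cont_prod S n xs).div_const q)).const_mul q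
  refine h.congr fun y => ?_
  simp only [Function.comp]
  field_simp

lemma main_nat {S n : ℕ} (hS : 2 ≤ S) (hn : 1 ≤ n) (Q : (Fin n → Fin S) → ℝ)
    (hQ0 : ∀ xs, 0 ≤ Q xs) (hQ1 : ∑ xs, Q xs = 1)
    (hQz : ∀ xs, Q xs = 0 → ∀ᵐ y ∂(uniformPrior S), ∏ i, fullDist S y (xs i) = 0) :
    Real.log (1 / ((S - 1).factorial : ℝ))
          + ((S : ℝ) - 1) / 2 * Real.log ((n : ℝ) * ((S : ℝ) - 1) / (2 * Real.pi * Real.exp 1))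
      ≤ ∫ y, ∑ xs : Fin n → Fin S, (∏ i, fullDist S y (xs i)) *
          Real.log ((∏ i, fullDist S y (xs i)) / Q xs) ∂(uniformPrior S) := by
  have := prior_prob hS
  have hpi := Real.pi_pos
  have hd : ((S - 1 : ℕ) : ℝ) = (S:ℝ) - 1 := by rw [Nat.cast_sub (by omega)]; simp
  have hd0 : (0:ℝ) < (S:ℝ) - 1 := by rw [← hd]; exact_mod_cast (by omega : 0 < S - 1)
  have hn0 : (0:ℝ) < n := by exact_mod_cast hn
  set V := (volume (Dlt (S-1))).toReal with hV
  have hV0 : 0 < V := Dlt_vol_pos (S-1) (by omega)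
  set b : ℝ := n * ((S:ℝ) - 1) / 2 with hb
  have hb0 : 0 < b := by positivity
  set c : (Fin n → Fin S) → (Fin (S-1) → ℝ) := fun xs i => emp xs (emb i) with hc
  set K : ℝ := Real.log V + ((S:ℝ)-1)/2 * Real.log (b / π) - ((S:ℝ)-1)/2 with hK
  have hK1 : Real.log (1 / ((S - 1).factorial : ℝ))
          + ((S : ℝ) - 1) / 2 * Real.log ((n : ℝ) * ((S : ℝ) - 1) / (2 * Real.pi * Real.exp 1)) ≤ K := by
    have h1 := Real.log_le_log (by positivity) (Dlt_vol (S-1) (by omega))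
    have h2 : (n : ℝ) * ((S : ℝ) - 1) / (2 * Real.pi * Real.exp 1) = b / π / Real.exp 1 := by
      rw [hb]; field_simp
    rw [h2, Real.log_div (x := b / π) (by positivity) (by positivity), Real.log_exp]
    linarith
  refine hK1.trans ?_
  have hpt : ∀ᵐ y ∂(uniformPrior S), K + (1 - ∑ xs, Q xs * (V * gau b (c xs) y)) ≤
      ∑ xs : Fin n → Fin S, (∏ i, fullDist S y (xs i)) *
          Real.log ((∏ i, fullDist S y (xs i)) / Q xs) := by
    have hall : ∀ᵐ y ∂(uniformPrior S), ∀ xs, Q xs = 0 → ∏ i, fullDist S y (xs i) = 0 := by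
      rw [ae_all_iff]; intro xs
      by_cases h : Q xs = 0
      · filter_upwards [hQz xs h] with y hy _ using hy
      · filter_upwards with y h' using absurd h' h
    filter_upwards [hall, prior_ae] with y hz hy
    have hsum := prod_sum_one n _ (fullDist_sum (by omega) y : ∑ j, fullDist S y j = 1)
    have hvar := total_var (n := n) (by omega) hn y hy
    have key : ∀ xs, (∏ i, fullDist S y (xs i)) * (Real.log V + Real.log (gau b (c xs) y))
        + ((∏ i, fullDist S y (xs i)) - Q xs * (V * gau b (c xs) y)) ≤
        (∏ i, fullDist S y (xs i)) * Real.log ((∏ i, fullDist S y (xs i)) / Q xs) := by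
      intro xs
      have hp0 : 0 ≤ ∏ i, fullDist S y (xs i) := Finset.prod_nonneg fun i _ => fullDist_nonneg hy _
      have hg := gau_pos hb0 (c xs) y
      specialize hz xs
      set p := ∏ i, fullDist S y (xs i)
      rcases hp0.eq_or_lt with h | h
      · rw [← h]; have := hQ0 xs; simp only [zero_mul, zero_sub, zero_add]
        have : 0 ≤ Q xs * (V * gau b (c xs) y) := by positivity
        linarith
      · have hq : 0 < Q xs := (hQ0 xs).lt_of_ne' fun h0 => h.ne' (hz h0)
        have hl := Real.log_le_sub_one_of_pos (x := Q xs * (V * gau b (c xs) y) / p) (by positivity)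
        rw [Real.log_div (by positivity) (by positivity), Real.log_mul (by positivity) (by positivity),
          Real.log_mul (by positivity) (by positivity)] at hl
        rw [Real.log_div (by positivity) (by positivity)]
        have := mul_le_mul_of_nonneg_left hl h.le
        rw [mul_sub p (_ / p), mul_div_cancel₀ _ h.ne'] at this
        linarith
    refine le_trans ?_ (Finset.sum_le_sum fun xs _ => key xs)
    have e : ∀ xs : Fin n → Fin S, (∏ i, fullDist S y (xs i)) * (Real.log V + Real.log (gau b (c xs) y))
        + ((∏ i, fullDist S y (xs i)) - Q xs * (V * gau b (c xs) y))
        = (∏ i, fullDist S y (xs i)) * (Real.log V + ((S:ℝ)-1)/2 * Real.log (b / π) + 1)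
          - b * ((∏ i, fullDist S y (xs i)) * ∑ i, (y i - emp xs (emb i)) ^ 2)
          - Q xs * (V * gau b (c xs) y) := by
      intro xs; rw [gau_log hb0, hd]; ring
    simp only [e, Finset.sum_sub_distrib, ← Finset.sum_mul, ← Finset.mul_sum, hsum]
    have := mul_le_mul_of_nonneg_left hvar hb0.le
    have h4 : b * (1 / n) = ((S:ℝ)-1)/2 := by rw [hb]; field_simp
    rw [h4] at this
    linarith
  have hgi : ∀ xs, Integrable (fun y => Q xs * (V * gau b (c xs) y)) (uniformPrior S) := fun xs =>
    prior_integrable hS (((cont_gau b (c xs)).const_mul V).const_mul (Q xs))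
  have hsi : Integrable (fun y => ∑ xs, Q xs * (V * gau b (c xs) y)) (uniformPrior S) :=
    integrable_finsetSum _ fun xs _ => hgi xs
  have hint := integral_mono_ae ((integrable_const K).add ((integrable_const 1).sub hsi))
    (prior_integrable hS (continuous_finsetSum _ fun xs _ => cont_plog xs (Q xs))) hpt
  refine le_trans ?_ hint
  rw [integral_add' (integrable_const K) ((integrable_const 1).sub hsi),
    integral_sub' (integrable_const 1) hsi, integral_finsetSum _ fun xs _ => hgi xs]
  simp only [integral_const_mul, integral_const, probReal_univ, one_smul]
  have : ∑ xs, Q xs * (V * ∫ y, gau b (c xs) y ∂(uniformPrior S)) ≤ ∑ xs, Q xs * 1 :=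
    Finset.sum_le_sum fun xs _ => mul_le_mul_of_nonneg_left (prior_gau hS hb0 (c xs)) (hQ0 xs)
  simp only [mul_one, hQ1] at this
  linarith

lemma main_bits {S n : ℕ} (hS : 2 ≤ S) (hn : 1 ≤ n) (Q : (Fin n → Fin S) → ℝ)
    (hQ0 : ∀ xs, 0 ≤ Q xs) (hQ1 : ∑ xs, Q xs = 1)
    (hQz : ∀ xs, Q xs = 0 → ∀ᵐ y ∂(uniformPrior S), ∏ i, fullDist S y (xs i) = 0) :
    Real.logb 2 (1 / ((S - 1).factorial : ℝ))
          + ((S : ℝ) - 1) / 2 * Real.logb 2 ((n : ℝ) * ((S : ℝ) - 1) / (2 * Real.pi * Real.exp 1))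
      ≤ ∫ y, ∑ xs : Fin n → Fin S, (∏ i, fullDist S y (xs i)) *
          Real.logb 2 ((∏ i, fullDist S y (xs i)) / Q xs) ∂(uniformPrior S) := by
  have h := main_nat hS hn Q hQ0 hQ1 hQz
  have hl : 0 < Real.log 2 := Real.log_pos (by norm_num)
  simp only [Real.logb, ← mul_div_assoc, ← Finset.sum_div, integral_div, ← add_div]
  exact div_le_div_of_nonneg_right h hl.le

lemma part_one (S n : ℕ) (hS : 2 ≤ S) (hn : 1 ≤ n) :
      Real.logb 2 (1 / ((S - 1).factorial : ℝ))
          + ((S : ℝ) - 1) / 2 *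
              Real.logb 2 ((n : ℝ) * ((S : ℝ) - 1) / (2 * Real.pi * Real.exp 1))
        ≤ mutInfo S n := by
  have := prior_prob hS
  have hnn : ∀ xs : Fin n → Fin S, ∀ᵐ y ∂(uniformPrior S), 0 ≤ ∏ i, fullDist S y (xs i) := by
    intro xs
    filter_upwards [prior_ae] with y hy using Finset.prod_nonneg fun i _ => fullDist_nonneg hy _
  refine main_bits hS hn (fun xs => ∫ y', ∏ i, fullDist S y' (xs i) ∂(uniformPrior S)) ?_ ?_ ?_
  · exact fun xs => integral_nonneg_of_ae (hnn xs)
  · rw [← integral_finsetSum _ fun xs _ => prior_integrable hS (cont_prod S n xs)]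
    simp [prod_sum_one n _ (fullDist_sum (by omega : 1 ≤ S) _)]
  · intro xs h
    exact (integral_eq_zero_iff_of_nonneg_ae (hnn xs) (prior_integrable hS (cont_prod S n xs))).1 h

lemma log_fact (d : ℕ) (hd : 1 ≤ d) :
    Real.log (d.factorial : ℝ) ≤ (d + 1) * Real.log d - d + 1 := by
  induction d, hd using Nat.le_induction with
  | base => simp
  | succ d hd ih =>
    have hd0 : (0:ℝ) < d := by exact_mod_cast hd
    rw [Nat.factorial_succ]
    push_cast
    rw [Real.log_mul (by positivity) (by positivity)]
    have h := Real.one_sub_inv_le_log_of_pos (x := ((d:ℝ) + 1) / d) (by positivity)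
    rw [Real.log_div (by positivity) (by positivity), inv_div] at h
    have h2 := mul_le_mul_of_nonneg_left h (by positivity : (0:ℝ) ≤ d + 1)
    have h3 : ((d:ℝ)+1) * (1 - d / (d+1)) = 1 := by field_simp; ring
    rw [h3] at h2
    linarith

/-- the redundancy values -/
def redSet (S n : ℕ) (Q : (Fin n → Fin S) → ℝ) : Set ℝ :=
  { d : ℝ | ∃ p ∈ stdSimplex ℝ (Fin S), d = (1 / n) * ∑ xs : Fin n → Fin S,
            (∏ i, p (xs i)) * Real.logb 2 ((∏ i, p (xs i)) / Q xs) }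

lemma redSet_bdd (S n : ℕ) (Q : (Fin n → Fin S) → ℝ) (hQ : ∀ xs, 0 < Q xs) :
    BddAbove (redSet S n Q) := by
  refine ⟨(1 / n) * ∑ xs, |Real.logb 2 (Q xs)|, ?_⟩
  rintro _ ⟨p, hp, rfl⟩
  gcongr with xs
  have h0 : 0 ≤ ∏ i, p (xs i) := Finset.prod_nonneg fun i _ => hp.1 _
  have h1 : ∏ i, p (xs i) ≤ 1 := Finset.prod_le_one (fun i _ => hp.1 _) fun i _ =>
    (Finset.single_le_sum (fun j _ => hp.1 j) (Finset.mem_univ (xs i))).trans hp.2.le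
  set t := ∏ i, p (xs i)
  rcases h0.eq_or_lt with h | h
  · rw [← h]; simp
  · rw [Real.logb_div h.ne' (hQ xs).ne']
    have h2 : Real.logb 2 t ≤ 0 := Real.logb_nonpos (by norm_num) h0 h1
    have h3 := neg_abs_le (Real.logb 2 (Q xs))
    have h4 := abs_nonneg (Real.logb 2 (Q xs))
    nlinarith

lemma red_ge (S n : ℕ) (hS : 1 ≤ S) (B : ℝ)
    (h : ∀ Q : (Fin n → Fin S) → ℝ, (∀ xs, 0 < Q xs) → (∑ xs, Q xs = 1) → B ≤ sSup (redSet S n Q)) :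
    B ≤ minimaxRedundancy S n := by
  have : Nonempty (Fin S) := ⟨⟨0, hS⟩⟩
  refine le_csInf ?_ ?_
  · refine ⟨_, fun _ => (Fintype.card (Fin n → Fin S) : ℝ)⁻¹, fun _ => ?_, ?_, rfl⟩
    · have : 0 < Fintype.card (Fin n → Fin S) := Fintype.card_pos
      positivity
    · simp
      have : (S:ℝ) ≠ 0 := by positivity
      field_simp
  · rintro _ ⟨Q, h0, h1, rfl⟩
    exact h Q h0 h1

lemma red_one (n : ℕ) : 0 ≤ minimaxRedundancy 1 n := by
  refine red_ge 1 n le_rfl 0 fun Q h0 h1 => ?_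
  refine le_csSup (redSet_bdd 1 n Q h0) ⟨fun _ => 1, ⟨fun _ => zero_le_one, by simp⟩, ?_⟩
  have hu : ∀ xs, Q xs = 1 := by
    intro xs
    rw [← h1, Fintype.sum_eq_single xs]
    intro x hx; exact absurd (Subsingleton.elim x xs) hx
  simp [hu]

lemma red_two (S n : ℕ) (hS : 2 ≤ S) (hn : 1 ≤ n) :
    (1 / n) * (Real.logb 2 (1 / ((S - 1).factorial : ℝ))
          + ((S : ℝ) - 1) / 2 *
              Real.logb 2 ((n : ℝ) * ((S : ℝ) - 1) / (2 * Real.pi * Real.exp 1)))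
      ≤ minimaxRedundancy S n := by
  have := prior_prob hS
  refine red_ge S n (by omega) _ fun Q h0 h1 => ?_
  have h := main_bits hS hn Q (fun xs => (h0 xs).le) h1 (fun xs h => absurd h (h0 xs).ne')
  have hn0 : (0:ℝ) < n := by exact_mod_cast hn
  have hpt : ∀ᵐ y ∂(uniformPrior S), ∑ xs : Fin n → Fin S, (∏ i, fullDist S y (xs i)) *
          Real.logb 2 ((∏ i, fullDist S y (xs i)) / Q xs) ≤ n * sSup (redSet S n Q) := by
    filter_upwards [prior_ae] with y hy
    have := le_csSup (redSet_bdd S n Q h0)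
      ⟨fullDist S y, ⟨fun j => fullDist_nonneg hy j, fullDist_sum (by omega) y⟩, rfl⟩
    rw [one_div, inv_mul_le_iff₀ hn0] at this
    exact this
  have hi : Integrable (fun y => ∑ xs : Fin n → Fin S, (∏ i, fullDist S y (xs i)) *
          Real.logb 2 ((∏ i, fullDist S y (xs i)) / Q xs)) (uniformPrior S) := by
    refine integrable_finsetSum _ fun xs _ => ?_
    simp only [Real.logb, ← mul_div_assoc]
    exact (prior_integrable hS (cont_plog xs (Q xs))).div_const _
  have h2 := integral_mono_ae hi (integrable_const _) hpt
  simp only [integral_const, probReal_univ, one_smul] at h2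
  rw [one_div, inv_mul_le_iff₀ hn0]
  exact h.trans h2

lemma part_two (α : ℝ) (hα : 0 < α) (hα2 : α < Real.exp 1 / (2 * Real.pi)) :
      ∃ C : ℝ, 0 < C ∧ ∀ n S : ℕ, 2 ≤ n → (S : ℝ) = α * n →
        α / 2 * Real.logb 2 (Real.exp 1 / (2 * Real.pi * α)) - C * Real.log n / n
          ≤ minimaxRedundancy S n := by
  have hpi := Real.pi_pos
  have hl : 0 < Real.log 2 := Real.log_pos (by norm_num)
  set L := Real.log (Real.exp 1 / (2 * Real.pi * α)) with hL
  have hL0 : 0 < L := by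
    refine Real.log_pos ?_
    rw [lt_div_iff₀ (by positivity)] at hα2 ⊢
    linarith
  have hα1 : α < 1 := by
    refine hα2.trans ?_
    rw [div_lt_one (by positivity)]
    linarith [Real.exp_one_lt_d9, Real.pi_gt_three]
  set C' := (L / 2 + 1) / Real.log 2 + 1 with hC'
  refine ⟨C' / Real.log 2, by positivity, fun n S hn hSn => ?_⟩
  have hn0 : (0:ℝ) < n := by exact_mod_cast (by omega : 0 < n)
  have hS1 : 1 ≤ S := by
    have : (0:ℝ) < S := by rw [hSn]; positivity
    exact_mod_cast this
  have hlogn : Real.log 2 ≤ Real.log n := Real.log_le_log (by norm_num) (by exact_mod_cast hn)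
  have hC1 : L / 2 + 1 + Real.log n ≤ C' * Real.log n := by
    rw [hC', add_mul, one_mul]
    have : L / 2 + 1 = (L / 2 + 1) / Real.log 2 * Real.log 2 := by field_simp
    have h2 : (L / 2 + 1) / Real.log 2 * Real.log 2 ≤ (L / 2 + 1) / Real.log 2 * Real.log n := by gcongr
    linarith
  have hlhs : α / 2 * Real.logb 2 (Real.exp 1 / (2 * Real.pi * α)) - C' / Real.log 2 * Real.log n / n
      = (1 / n) * ((α * n / 2 * L - C' * Real.log n) / Real.log 2) := by
    rw [Real.logb, ← hL]; field_simp
  rw [hlhs]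
  rcases hS1.eq_or_lt with h | h
  · rw [← h]
    refine le_trans ?_ (red_one n)
    have : α * n = 1 := by rw [← hSn, ← h]; simp
    rw [this]
    refine mul_nonpos_of_nonneg_of_nonpos (by positivity) ?_
    refine div_nonpos_of_nonpos_of_nonneg ?_ hl.le
    linarith
  · refine le_trans ?_ (red_two S n h (by omega))
    refine mul_le_mul_of_nonneg_left ?_ (by positivity)
    simp only [Real.logb]
    rw [← mul_div_assoc, ← add_div]
    refine div_le_div_of_nonneg_right ?_ hl.le
    have hd : ((S - 1 : ℕ) : ℝ) = (S:ℝ) - 1 := by rw [Nat.cast_sub (by omega)]; simp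
    have hf := log_fact (S - 1) (by omega)
    rw [hd] at hf
    have hd1 : (1:ℝ) ≤ (S:ℝ) - 1 := by rw [← hd]; exact_mod_cast (by omega : 1 ≤ S - 1)
    set d := (S:ℝ) - 1 with hdd
    have hdn : d ≤ α * n := by linarith
    have hd0 : 0 < d := by linarith
    have hlogd : Real.log d ≤ Real.log n := Real.log_le_log hd0 (by nlinarith)
    rw [one_div, Real.log_inv]
    have e1 : Real.log (n * d / (2 * π * Real.exp 1)) = Real.log n + Real.log d - Real.log (2 * π) - 1 := by
      rw [Real.log_div (by positivity) (by positivity), Real.log_mul (by positivity) (by positivity),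
        Real.log_mul (by positivity) (by positivity), Real.log_exp]; ring
    have e2 : L = 1 - Real.log (2 * π) - Real.log α := by
      rw [hL, Real.log_div (by positivity) (by positivity), Real.log_mul (by positivity) (by positivity),
        Real.log_exp]; ring
    have e3 : Real.log d ≤ Real.log α + Real.log n := by
      rw [← Real.log_mul (by positivity) (by positivity)]
      exact Real.log_le_log hd0 hdn
    rw [e1]
    have e4 : d / 2 * L ≤ d / 2 * (1 - Real.log (2 * π) + Real.log n - Real.log d) := by
      gcongr; linarith
    have e5 : α * n = d + 1 := by rw [← hSn, hdd]; ring
    rw [e5]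
    linarith

/-- (i) For the uniform prior on the simplex,
`I(P;X^n) ≥ log₂(1/(S−1)!) + ((S−1)/2) log₂(n(S−1)/(2πe))`.
(ii) Consequently, if `S = αn` with `0 < α < e/(2π)`, the normalized minimax redundancy is at
least `(α/2) log₂(e/(2πα)) − O(log n / n)`. -/
theorem stmt_19 :
    (∀ S n : ℕ, 2 ≤ S → 1 ≤ n →
      Real.logb 2 (1 / ((S - 1).factorial : ℝ))
          + ((S : ℝ) - 1) / 2 *
              Real.logb 2 ((n : ℝ) * ((S : ℝ) - 1) / (2 * Real.pi * Real.exp 1))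
        ≤ mutInfo S n) ∧
    (∀ α : ℝ, 0 < α → α < Real.exp 1 / (2 * Real.pi) →
      ∃ C : ℝ, 0 < C ∧ ∀ n S : ℕ, 2 ≤ n → (S : ℝ) = α * n →
        α / 2 * Real.logb 2 (Real.exp 1 / (2 * Real.pi * α)) - C * Real.log n / n
          ≤ minimaxRedundancy S n) := by
  exact ⟨part_one, part_two⟩
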